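/- arXiv:1410.7036 — 3 statements merged into one kernel-verified Lean document; each statement's English description precedes it below -/
import Mathlib

section
/- γ - ln(π) - 2·ln(2) + 9/4 = Σ_{n=1}^∞ (2·N₁(n) + 3)/(2n(2n+1)(2n+2)), where γ is the Euler–Mascheroni constant and N₁(n) is the number of ones in the binary expansion of n. -/
open Filter Topology Finset

/-- The number of ones in the binary expansion of `n`. -/
def binaryOnes (n : ℕ) : ℕ := (Nat.digits 2 n).count 1

lemma binaryOnes_zero : binaryOnes 0 = 0 := by simp [binaryOnes]

lemma binaryOnes_two_mul (n : ℕ) : binaryOnes (2 * n) = binaryOnes n := by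
  rcases Nat.eq_zero_or_pos n with rfl | hn
  · simp
  · have h := Nat.digits_add 2 one_lt_two 0 n two_pos (Or.inr hn.ne')
    rw [zero_add] at h
    simp only [binaryOnes, h, List.count_cons]
    simp

lemma binaryOnes_two_mul_add_one (n : ℕ) :
    binaryOnes (2 * n + 1) = binaryOnes n + 1 := by
  have h := Nat.digits_add 2 one_lt_two 1 n one_lt_two (Or.inl one_ne_zero)
  rw [add_comm 1 (2 * n)] at h
  simp only [binaryOnes, h, List.count_cons_self]

lemma binaryOnes_le (n : ℕ) : binaryOnes n ≤ n := by
  induction n using Nat.strong_induction_on with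
  | _ n ih =>
    rcases Nat.even_or_odd' n with ⟨k, rfl | rfl⟩
    · rw [binaryOnes_two_mul]
      rcases Nat.eq_zero_or_pos k with rfl | hk
      · simp [binaryOnes_zero]
      · have := ih k (by omega)
        omega
    · rw [binaryOnes_two_mul_add_one]
      have := ih k (by omega)
      omega

/-- Twice the error of the trapezoidal rule for `∫ x in n..n + 1, 1 / x`. -/
noncomputable def trapezoidError (n : ℕ) : ℝ :=
  1 / (n : ℝ) + 1 / ((n : ℝ) + 1) - 2 * (Real.log ((n : ℝ) + 1) - Real.log n)

lemma trapezoidError_nonneg {n : ℕ} (hn : 0 < n) : 0 ≤ trapezoidError n := by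
  have hn' : (0 : ℝ) < n := by exact_mod_cast hn
  have hlog : 0 ≤ Real.log (((n : ℝ) + 1) / n) :=
    Real.log_nonneg (by rw [le_div_iff₀ hn']; linarith)
  have h := Real.self_le_sinh_iff.mpr hlog
  rw [Real.sinh_log (by positivity), Real.log_div (by positivity) (by positivity)] at h
  have e : 1 / (n : ℝ) + 1 / ((n : ℝ) + 1) =
      ((n : ℝ) + 1) / n - (((n : ℝ) + 1) / n)⁻¹ := by
    field_simp
    ring
  rw [trapezoidError, e]
  linarith

lemma trapezoidError_le {n : ℕ} (hn : 0 < n) :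
    trapezoidError n ≤ 1 / ((n : ℝ) * (n + 1) * (2 * n + 1)) := by
  have hn' : (0 : ℝ) < n := by exact_mod_cast hn
  have h := Real.le_log_one_add_of_nonneg (x := 1 / (n : ℝ)) (by positivity)
  rw [show 1 + 1 / (n : ℝ) = ((n : ℝ) + 1) / n by field_simp,
    Real.log_div (by positivity) (by positivity)] at h
  have e : 1 / ((n : ℝ) * (n + 1) * (2 * n + 1)) =
      1 / (n : ℝ) + 1 / ((n : ℝ) + 1) - 2 * (2 * (1 / (n : ℝ)) / (1 / (n : ℝ) + 2)) := by
    field_simp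
    ring
  rw [trapezoidError, e]
  linarith

lemma trapezoidError_sub {n : ℕ} (hn : 0 < n) :
    trapezoidError n - trapezoidError (2 * n) - trapezoidError (2 * n + 1) =
      2 / (2 * (n : ℝ) * (2 * n + 1) * (2 * n + 2)) := by
  have hn' : (0 : ℝ) < n := by exact_mod_cast hn
  have h1 : Real.log (2 * n + 1 + 1) = Real.log 2 + Real.log ((n : ℝ) + 1) := by
    rw [← Real.log_mul (by norm_num) (by positivity)]
    ring_nf
  have h2 : Real.log (2 * (n : ℝ)) = Real.log 2 + Real.log n :=
    Real.log_mul (by norm_num) hn'.ne'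
  simp only [trapezoidError]
  push_cast
  rw [h1, h2]
  field_simp
  ring

lemma sum_binaryOnes_div (N : ℕ) :
    ∑ n ∈ range N, (binaryOnes n : ℝ) * (2 / (2 * (n : ℝ) * (2 * n + 1) * (2 * n + 2))) =
      ∑ k ∈ range N, trapezoidError (2 * k + 1) -
        ∑ n ∈ Ico N (2 * N), (binaryOnes n : ℝ) * trapezoidError n := by
  rw [sum_Ico_eq_sub _ (by omega)]
  induction N with
  | zero => simp
  | succ N ih =>
    rw [show 2 * (N + 1) = 2 * N + 1 + 1 by ring]
    simp only [sum_range_succ, ih, binaryOnes_two_mul, binaryOnes_two_mul_add_one]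
    rcases Nat.eq_zero_or_pos N with rfl | hN
    · simp [binaryOnes_zero]
    · rw [← trapezoidError_sub hN]
      push_cast
      ring

lemma tendsto_sum_Ico_binaryOnes_mul_trapezoidError :
    Tendsto (fun N : ℕ ↦ ∑ n ∈ Ico N (2 * N), (binaryOnes n : ℝ) * trapezoidError n)
      atTop (𝓝 0) := by
  refine squeeze_zero (fun N ↦ sum_nonneg fun n _ ↦ ?_) (fun N ↦ ?_)
    tendsto_one_div_add_atTop_nhds_zero_nat
  · rcases Nat.eq_zero_or_pos n with rfl | hn
    · simp [binaryOnes_zero]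
    · exact mul_nonneg (Nat.cast_nonneg _) (trapezoidError_nonneg hn)
  · have hterm : ∀ n ∈ Ico N (2 * N),
        (binaryOnes n : ℝ) * trapezoidError n ≤ 1 / ((N : ℝ) + 1) ^ 2 := by
      intro n hmem
      obtain ⟨h1, h2⟩ := mem_Ico.mp hmem
      have hn : 0 < n := by omega
      have hn' : (0 : ℝ) < n := by exact_mod_cast hn
      have hNn : (N : ℝ) ≤ n := by exact_mod_cast h1
      have hb : (binaryOnes n : ℝ) ≤ n := by exact_mod_cast binaryOnes_le n
      calc (binaryOnes n : ℝ) * trapezoidError n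
          ≤ n * (1 / ((n : ℝ) * (n + 1) * (2 * n + 1))) :=
            mul_le_mul hb (trapezoidError_le hn) (trapezoidError_nonneg hn) hn'.le
        _ = 1 / (((n : ℝ) + 1) * (2 * n + 1)) := by field_simp
        _ ≤ 1 / ((N : ℝ) + 1) ^ 2 := by
            rw [sq]
            gcongr
            linarith
    refine (sum_le_card_nsmul _ _ _ hterm).trans ?_
    rw [Nat.card_Ico, show 2 * N - N = N by omega, nsmul_eq_mul, mul_one_div,
      div_le_div_iff₀ (by positivity) (by positivity)]
    nlinarith [(Nat.cast_nonneg N : (0 : ℝ) ≤ N)]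

lemma sum_trapezoidError_odd (K : ℕ) :
    ∑ k ∈ range K, trapezoidError (2 * k + 1) =
      (harmonic (2 * K) - Real.log ((2 * K : ℕ) + 1)) - Real.log (Real.Wallis.W K) := by
  induction K with
  | zero => simp [Real.Wallis.W]
  | succ K ih =>
    rw [sum_range_succ, ih, Real.Wallis.W_succ,
      Real.log_mul (Real.Wallis.W_pos K).ne' (by positivity),
      Real.log_mul (by positivity) (by positivity), Real.log_div (by positivity) (by positivity),
      Real.log_div (by positivity) (by positivity), show 2 * (K + 1) = 2 * K + 1 + 1 by ring,
      harmonic_succ, harmonic_succ, trapezoidError]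
    push_cast
    rw [show (2 * (K : ℝ) + 1 + 1) = 2 * K + 2 by ring,
      show (2 * (K : ℝ) + 2 + 1) = 2 * K + 3 by ring]
    ring

lemma tendsto_two_mul_atTop : Tendsto (fun N : ℕ ↦ 2 * N) atTop atTop :=
  tendsto_id.const_mul_atTop' two_pos

lemma tendsto_sum_trapezoidError_odd :
    Tendsto (fun K : ℕ ↦ ∑ k ∈ range K, trapezoidError (2 * k + 1)) atTop
      (𝓝 (Real.eulerMascheroniConstant - Real.log (Real.pi / 2))) := by
  simp only [sum_trapezoidError_odd]
  exact (Real.tendsto_harmonic_sub_log_add_one.comp tendsto_two_mul_atTop).sub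
    (Real.Wallis.tendsto_W_nhds_pi_div_two.log (by positivity))

lemma tendsto_harmonic_two_mul_sub_harmonic :
    Tendsto (fun N : ℕ ↦ ((harmonic (2 * N) : ℝ) - harmonic N)) atTop (𝓝 (Real.log 2)) := by
  have h := ((Real.tendsto_harmonic_sub_log.comp tendsto_two_mul_atTop).sub
    Real.tendsto_harmonic_sub_log).add_const (Real.log 2)
  rw [sub_self, zero_add] at h
  refine h.congr' ?_
  filter_upwards [eventually_gt_atTop 0] with N hN
  have hN' : (N : ℝ) ≠ 0 := by exact_mod_cast hN.ne'
  simp only [Function.comp_apply]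
  push_cast
  rw [Real.log_mul (by norm_num) hN']
  ring

lemma sum_two_div_eq_harmonic (N : ℕ) :
    ∑ n ∈ range (N + 1), 2 / (2 * (n : ℝ) * (2 * n + 1) * (2 * n + 2)) =
      3 / 2 - 2 * ((harmonic (2 * (N + 1)) : ℝ) - harmonic (N + 1)) -
        1 / 2 * (1 / ((N : ℝ) + 1)) := by
  induction N with
  | zero => norm_num [harmonic_succ]
  | succ N ih =>
    rw [sum_range_succ, ih, show 2 * (N + 1 + 1) = 2 * (N + 1) + 1 + 1 by ring,
      harmonic_succ (2 * (N + 1) + 1), harmonic_succ (2 * (N + 1)), harmonic_succ (N + 1)]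
    push_cast
    field_simp
    ring

lemma tendsto_sum_two_div :
    Tendsto (fun N : ℕ ↦ ∑ n ∈ range (N + 1), 2 / (2 * (n : ℝ) * (2 * n + 1) * (2 * n + 2)))
      atTop (𝓝 (3 / 2 - 2 * Real.log 2)) := by
  simp only [sum_two_div_eq_harmonic]
  simpa using ((tendsto_harmonic_two_mul_sub_harmonic.comp (tendsto_add_atTop_nat 1)).const_mul
    2).const_sub (3 / 2) |>.sub (tendsto_one_div_add_atTop_nhds_zero_nat.const_mul (1 / 2 : ℝ))

/-- `γ - ln(π) - 2 ln 2 + 9/4 = Σ_{n≥1} (2·N₁(n)+3)/(2n(2n+1)(2n+2))`. -/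
theorem euler_log_pi_series :
    Real.eulerMascheroniConstant - Real.log Real.pi - 2 * Real.log 2 + 9 / 4 =
      ∑' n : ℕ, (2 * ((Nat.digits 2 (n + 1)).count 1 : ℝ) + 3) /
        (2 * (n + 1 : ℝ) * (2 * (n + 1 : ℝ) + 1) * (2 * (n + 1 : ℝ) + 2)) := by
  refine (HasSum.tsum_eq ?_).symm
  rw [hasSum_iff_tendsto_nat_of_nonneg (fun n ↦ by positivity)]
  have hones := (tendsto_sum_trapezoidError_odd.sub
    tendsto_sum_Ico_binaryOnes_mul_trapezoidError).comp (tendsto_add_atTop_nat 1)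
  have h := hones.add (tendsto_sum_two_div.const_mul (3 / 2))
  rw [Real.log_div Real.pi_ne_zero two_ne_zero] at h
  convert h using 2 with N
  · simp only [Function.comp_apply]
    rw [← sum_binaryOnes_div, mul_sum, ← sum_add_distrib, sum_range_succ']
    simp only [CharP.cast_eq_zero, mul_zero, zero_mul, div_zero, add_zero]
    refine sum_congr rfl fun n _ ↦ ?_
    rw [binaryOnes]
    push_cast
    ring
  · ring
end

section
/- γ = Σ_{n=1}^∞ (N₁(n) + N₀(n))/(2n(2n+1)), where γ is the Euler–Mascheroni constant, N₁(n) is the number of ones and N₀(n) the number of zeros in the binary expansion of n. -/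
open Filter Topology Real

theorem List.count_one_add_count_zero {l : List ℕ} (hl : ∀ d ∈ l, d < 2) :
    l.count 1 + l.count 0 = l.length := by
  induction l with
  | nil => rfl
  | cons a l ih =>
    have ih := ih fun d hd => hl d (List.mem_cons_of_mem a hd)
    have ha : a < 2 := hl a List.mem_cons_self
    interval_cases a <;> simp <;> omega

theorem Nat.count_digits_two {n : ℕ} (hn : n ≠ 0) :
    (Nat.digits 2 n).count 1 + (Nat.digits 2 n).count 0 = Nat.log 2 n + 1 := by
  rw [List.count_one_add_count_zero fun d hd => Nat.digits_lt_base one_lt_two hd,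
    Nat.length_digits 2 n one_lt_two hn]

theorem sum_one_div_two_mul_two_mul_add_one (n : ℕ) :
    ∑ i ∈ Finset.range n, 1 / (2 * (i + 1 : ℝ) * (2 * (i + 1 : ℝ) + 1)) =
      harmonic n - harmonic (2 * n + 1) + 1 := by
  induction n with
  | zero => simp [harmonic]
  | succ n ih =>
    rw [Finset.sum_range_succ, ih, show 2 * (n + 1) + 1 = 2 * n + 1 + 1 + 1 by ring,
      harmonic_succ n, harmonic_succ (2 * n + 1 + 1), harmonic_succ (2 * n + 1)]
    push_cast
    field_simp
    ring

/-- The sum over the integers with at most `k` binary digits. -/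
theorem sum_log_two_add_one_div (k : ℕ) :
    ∑ i ∈ Finset.range (2 ^ k - 1),
        ((Nat.log 2 (i + 1) + 1 : ℕ) : ℝ) / (2 * (i + 1 : ℝ) * (2 * (i + 1 : ℝ) + 1)) =
      harmonic (2 ^ k - 1) - k * (harmonic (2 ^ (k + 1) - 1) - harmonic (2 ^ k - 1)) := by
  induction k with
  | zero => simp
  | succ k ih =>
    have hpos : 0 < 2 ^ k := by positivity
    have hle : 2 ^ k - 1 ≤ 2 ^ (k + 1) - 1 := by
      rw [pow_succ]; omega
    have hblock : ∑ i ∈ (Finset.Ico (2 ^ k - 1) (2 ^ (k + 1) - 1) : Finset ℕ),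
        ((Nat.log 2 (i + 1) + 1 : ℕ) : ℝ) / (2 * (i + 1 : ℝ) * (2 * (i + 1 : ℝ) + 1)) =
        (k + 1) * ∑ i ∈ (Finset.Ico (2 ^ k - 1) (2 ^ (k + 1) - 1) : Finset ℕ),
          1 / (2 * (i + 1 : ℝ) * (2 * (i + 1 : ℝ) + 1)) := by
      rw [Finset.mul_sum]
      refine Finset.sum_congr rfl fun i hi => ?_
      rw [Finset.mem_Ico] at hi
      rw [Nat.log_eq_of_pow_le_of_lt_pow (m := k) (by omega) (by omega)]
      push_cast
      ring
    rw [← Finset.sum_range_add_sum_Ico _ hle, ih, hblock, Finset.sum_Ico_eq_sub _ hle,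
      sum_one_div_two_mul_two_mul_add_one, sum_one_div_two_mul_two_mul_add_one,
      show 2 * (2 ^ k - 1) + 1 = 2 ^ (k + 1) - 1 by rw [pow_succ]; omega,
      show 2 * (2 ^ (k + 1) - 1) + 1 = 2 ^ (k + 1 + 1) - 1 by
        rw [pow_succ _ (k + 1), pow_succ]; omega]
    push_cast
    ring

theorem eulerMascheroniSeq_two_pow_sub_one (k : ℕ) :
    eulerMascheroniSeq (2 ^ k - 1) = harmonic (2 ^ k - 1) - k * log 2 := by
  have hcast : ((2 ^ k - 1 : ℕ) : ℝ) + 1 = 2 ^ k := by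
    rw [Nat.cast_sub Nat.one_le_two_pow]; simp
  rw [eulerMascheroniSeq, hcast, log_pow]

theorem eulerMascheroniConstant_sub_eulerMascheroniSeq_lt (k : ℕ) :
    eulerMascheroniConstant - eulerMascheroniSeq (2 ^ k - 1) < 1 / 2 ^ k := by
  have h := eulerMascheroniConstant_lt_eulerMascheroniSeq' (2 ^ k)
  have hk : 2 ^ k = 2 ^ k - 1 + 1 := (Nat.sub_add_cancel Nat.one_le_two_pow).symm
  have hharm : harmonic (2 ^ k) = harmonic (2 ^ k - 1) + (2 ^ k)⁻¹ := by
    conv_lhs => rw [hk, harmonic_succ, ← hk]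
    simp
  rw [eulerMascheroniSeq', if_neg (by positivity), hharm] at h
  push_cast at h
  rw [log_pow] at h
  rw [eulerMascheroniSeq_two_pow_sub_one, one_div]
  linarith

theorem tendsto_mul_eulerMascheroniSeq_two_pow_sub :
    Tendsto (fun k : ℕ =>
      (k : ℝ) * (eulerMascheroniSeq (2 ^ (k + 1) - 1) - eulerMascheroniSeq (2 ^ k - 1)))
      atTop (𝓝 0) := by
  have hlim := tendsto_pow_const_div_const_pow_of_one_lt 1 (one_lt_two : (1 : ℝ) < 2)
  refine squeeze_zero (fun k => ?_) (fun k => ?_) hlim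
  · refine mul_nonneg k.cast_nonneg (sub_nonneg.2 (strictMono_eulerMascheroniSeq.monotone ?_))
    exact Nat.sub_le_sub_right (Nat.pow_le_pow_right two_pos k.le_succ) 1
  · rw [pow_one, div_eq_mul_one_div]
    refine mul_le_mul_of_nonneg_left ?_ k.cast_nonneg
    have h1 := eulerMascheroniConstant_sub_eulerMascheroniSeq_lt k
    have h2 := eulerMascheroniSeq_lt_eulerMascheroniConstant (2 ^ (k + 1) - 1)
    linarith

theorem hasSum_log_two_add_one_div :
    HasSum (fun i : ℕ =>
        ((Nat.log 2 (i + 1) + 1 : ℕ) : ℝ) / (2 * (i + 1 : ℝ) * (2 * (i + 1 : ℝ) + 1)))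
      eulerMascheroniConstant := by
  have hnonneg (i : ℕ) : 0 ≤
      ((Nat.log 2 (i + 1) + 1 : ℕ) : ℝ) / (2 * (i + 1 : ℝ) * (2 * (i + 1 : ℝ) + 1)) := by
    positivity
  have hpow : Tendsto (fun k : ℕ => 2 ^ k - 1) atTop atTop :=
    (tendsto_sub_atTop_nat 1).comp (tendsto_pow_atTop_atTop_of_one_lt one_lt_two)
  rw [hasSum_iff_tendsto_nat_of_nonneg hnonneg,
    tendsto_iff_tendsto_subseq_of_monotone
      (fun m n h => Finset.sum_le_sum_of_subset_of_nonneg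
        (Finset.range_mono h) fun i _ _ => hnonneg i) hpow]
  have hlim := (tendsto_eulerMascheroniSeq.comp hpow).sub
    tendsto_mul_eulerMascheroniSeq_two_pow_sub
  rw [sub_zero] at hlim
  refine hlim.congr fun k => ?_
  simp only [Function.comp_apply]
  rw [sum_log_two_add_one_div, eulerMascheroniSeq_two_pow_sub_one,
    eulerMascheroniSeq_two_pow_sub_one]
  push_cast
  ring

/-- `γ = Σ_{n≥1} (N₁(n)+N₀(n))/(2n(2n+1))`. -/
theorem euler_binary_digit_series :
    Real.eulerMascheroniConstant =
      ∑' n : ℕ,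
        (((Nat.digits 2 (n + 1)).count 1 : ℝ) + ((Nat.digits 2 (n + 1)).count 0 : ℝ)) /
          (2 * (n + 1 : ℝ) * (2 * (n + 1 : ℝ) + 1)) := by
  rw [← hasSum_log_two_add_one_div.tsum_eq]
  refine tsum_congr fun n => ?_
  rw [← Nat.count_digits_two n.succ_ne_zero, Nat.cast_add]
end

section
/- ln(4/π) = Σ_{n=2}^∞ (-1)^n · (N₁(⌊n/2⌋) - N₀(⌊n/2⌋))/n, where the sum is interpreted as the limit of partial sums, and N₁(m), N₀(m) are the numbers of ones and zeros in the binary expansion of m. -/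
open Filter

/-- The excess of ones over zeros in the binary expansion of `m`. -/
def binaryExcess (m : ℕ) : ℤ :=
  ((Nat.digits 2 m).count 1 : ℤ) - ((Nat.digits 2 m).count 0 : ℤ)

/-- The gap `1/k - log ((k+1)/k)` between a harmonic term and its logarithmic approximation. -/
noncomputable def harmonicLogGap (k : ℕ) : ℝ :=
  1 / (k : ℝ) - Real.log (((k : ℝ) + 1) / k)

lemma binaryExcess_zero : binaryExcess 0 = 0 := by simp [binaryExcess]

lemma binaryExcess_two_mul {m : ℕ} (hm : m ≠ 0) :
    binaryExcess (2 * m) = binaryExcess m - 1 := by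
  rw [binaryExcess, Nat.digits_def' one_lt_two (by omega)]
  simp [binaryExcess]
  ring

lemma binaryExcess_two_mul_add_one (m : ℕ) :
    binaryExcess (2 * m + 1) = binaryExcess m + 1 := by
  have h : (2 * m + 1) / 2 = m := by omega
  rw [binaryExcess, Nat.digits_def' one_lt_two (by omega), h]
  simp [binaryExcess, Nat.add_mod]
  ring

lemma abs_binaryExcess_le (m : ℕ) : |(binaryExcess m : ℝ)| ≤ 3 * √m := by
  induction m using Nat.strong_induction_on with
  | _ n ih =>
  have key {m : ℕ} (hm : 1 ≤ m) : 3 * √m + 1 ≤ 3 * √(2 * m : ℝ) := by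
    have h1 : 1 ≤ √(m : ℝ) := Real.one_le_sqrt.mpr (by exact_mod_cast hm)
    have h2 : (7 / 5 : ℝ) ≤ √2 := Real.le_sqrt_of_sq_le (by norm_num)
    rw [Real.sqrt_mul (by norm_num)]
    nlinarith
  obtain ⟨m, rfl | rfl⟩ := Nat.even_or_odd' n
  · rcases Nat.eq_zero_or_pos m with rfl | hm
    · simp [binaryExcess_zero]
    · have h := ih m (by omega)
      have := key hm
      rw [binaryExcess_two_mul hm.ne']
      push_cast
      rw [abs_le] at h ⊢
      constructor <;> linarith
  · rcases Nat.eq_zero_or_pos m with rfl | hm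
    · simp [binaryExcess]
    · have h := ih m (by omega)
      have := key hm
      have h3 : √(2 * m : ℝ) ≤ √(2 * m + 1 : ℝ) := Real.sqrt_le_sqrt (by linarith)
      rw [binaryExcess_two_mul_add_one]
      push_cast
      rw [abs_le] at h ⊢
      constructor <;> linarith

lemma harmonicLogGap_zero : harmonicLogGap 0 = 0 := by simp [harmonicLogGap]

lemma harmonicLogGap_nonneg (k : ℕ) : 0 ≤ harmonicLogGap k := by
  rcases Nat.eq_zero_or_pos k with rfl | hk
  · rw [harmonicLogGap_zero]
  have hk' : (0 : ℝ) < k := by exact_mod_cast hk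
  have h := Real.log_le_sub_one_of_pos (x := ((k : ℝ) + 1) / k) (by positivity)
  have h2 : ((k : ℝ) + 1) / k - 1 = 1 / k := by field_simp; ring
  rw [harmonicLogGap]
  linarith

lemma harmonicLogGap_le (k : ℕ) : harmonicLogGap k ≤ 1 / (k : ℝ) ^ 2 := by
  rcases Nat.eq_zero_or_pos k with rfl | hk
  · simp [harmonicLogGap_zero]
  have hk' : (0 : ℝ) < k := by exact_mod_cast hk
  have h := Real.one_sub_inv_le_log_of_pos (x := ((k : ℝ) + 1) / k) (by positivity)
  have h2 : 1 / (k : ℝ) - (1 - (((k : ℝ) + 1) / k)⁻¹) = 1 / (k * (k + 1)) := by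
    field_simp; ring
  have h3 : 1 / ((k : ℝ) * (k + 1)) ≤ 1 / (k : ℝ) ^ 2 := by
    apply one_div_le_one_div_of_le (by positivity)
    nlinarith
  rw [harmonicLogGap]
  linarith

lemma harmonicLogGap_eq {m : ℕ} (hm : m ≠ 0) :
    1 / (2 * m : ℝ) - 1 / (2 * m + 1) =
      harmonicLogGap m - harmonicLogGap (2 * m) - harmonicLogGap (2 * m + 1) := by
  have h0 : (0 : ℝ) < m := by exact_mod_cast Nat.pos_of_ne_zero hm
  have h : Real.log (((m : ℝ) + 1) / m) =
      Real.log ((2 * m + 1) / (2 * m)) + Real.log ((2 * m + 1 + 1) / (2 * m + 1)) := by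
    rw [← Real.log_mul (by positivity) (by positivity)]
    congr 1
    field_simp
    ring
  simp only [harmonicLogGap]
  push_cast
  rw [h]
  field_simp
  ring

lemma sum_binaryExcess_eq (M : ℕ) :
    ∑ m ∈ Finset.range M, (binaryExcess m : ℝ) * (1 / (2 * m : ℝ) - 1 / (2 * m + 1)) =
      (∑ i ∈ Finset.range M, (harmonicLogGap (2 * i + 1) - harmonicLogGap (2 * i + 2))
        + harmonicLogGap (2 * M))
      - ∑ k ∈ Finset.Ico M (2 * M), (binaryExcess k : ℝ) * harmonicLogGap k := by
  rw [Finset.sum_Ico_eq_sub _ (by omega)]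
  induction M with
  | zero => simp [harmonicLogGap_zero]
  | succ M ih =>
    rw [Finset.sum_range_succ, ih, show 2 * (M + 1) = 2 * M + 1 + 1 by ring]
    simp only [Finset.sum_range_succ]
    rw [binaryExcess_two_mul_add_one]
    rcases Nat.eq_zero_or_pos M with rfl | hM
    · simp [binaryExcess_zero, harmonicLogGap_zero]
    · rw [binaryExcess_two_mul hM.ne', harmonicLogGap_eq hM.ne']
      push_cast
      ring

lemma tendsto_sum_alternating_harmonic :
    Tendsto (fun M : ℕ => ∑ i ∈ Finset.range M, (1 / (2 * i + 1 : ℝ) - 1 / (2 * i + 2)))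
      atTop (nhds (Real.log 2)) := by
  have hH (M : ℕ) : ∑ i ∈ Finset.range M, (1 / (2 * i + 1 : ℝ) - 1 / (2 * i + 2)) =
      (harmonic (2 * M) : ℝ) - (harmonic M : ℝ) := by
    induction M with
    | zero => simp
    | succ M ih =>
      rw [Finset.sum_range_succ, ih, show 2 * (M + 1) = 2 * M + 1 + 1 by ring]
      simp only [harmonic_succ]
      push_cast
      field_simp
      ring
  have h := Real.tendsto_harmonic_sub_log
  have h2 := h.comp (tendsto_id.const_mul_atTop' (show 0 < 2 by norm_num))
  have h3 := (h2.sub h).add_const (Real.log 2)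
  simp only [sub_self, zero_add] at h3
  refine h3.congr' ?_
  filter_upwards [eventually_gt_atTop 0] with M hM
  have hM' : (M : ℝ) ≠ 0 := by exact_mod_cast hM.ne'
  simp only [Function.comp, id, hH]
  push_cast
  rw [Real.log_mul two_ne_zero hM']
  ring

lemma sum_harmonicLogGap_eq (M : ℕ) :
    ∑ i ∈ Finset.range M, (harmonicLogGap (2 * i + 1) - harmonicLogGap (2 * i + 2)) =
      ∑ i ∈ Finset.range M, (1 / (2 * i + 1 : ℝ) - 1 / (2 * i + 2)) -
        Real.log (Real.Wallis.W M) := by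
  induction M with
  | zero => simp [Real.Wallis.W]
  | succ M ih =>
    have hW := Real.Wallis.W_pos M
    rw [Finset.sum_range_succ, ih, Finset.sum_range_succ, Real.Wallis.W_succ,
      Real.log_mul hW.ne' (by positivity), Real.log_mul (by positivity) (by positivity)]
    have h : Real.log ((2 * M + 2 : ℝ) / (2 * M + 3)) =
        -Real.log ((2 * M + 2 + 1 : ℝ) / (2 * M + 2)) := by
      rw [← Real.log_inv, inv_div]
      ring_nf
    simp only [harmonicLogGap]
    push_cast
    rw [h, show (2 * M + 1 + 1 : ℝ) = 2 * M + 2 by ring]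
    ring

lemma tendsto_sum_harmonicLogGap :
    Tendsto (fun M : ℕ => ∑ i ∈ Finset.range M,
        (harmonicLogGap (2 * i + 1) - harmonicLogGap (2 * i + 2)))
      atTop (nhds (Real.log (4 / Real.pi))) := by
  have hpi := Real.pi_pos
  have h := tendsto_sum_alternating_harmonic.sub
    ((Real.continuousAt_log (by positivity)).tendsto.comp Real.Wallis.tendsto_W_nhds_pi_div_two)
  rw [← Real.log_div (by positivity) (by positivity)] at h
  convert h using 2
  · exact sum_harmonicLogGap_eq _
  · congr 1
    field_simp
    norm_num

lemma tendsto_harmonicLogGap : Tendsto harmonicLogGap atTop (nhds 0) := by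
  refine squeeze_zero harmonicLogGap_nonneg harmonicLogGap_le ?_
  have h := (tendsto_one_div_atTop_nhds_zero_nat (𝕜 := ℝ)).pow 2
  simpa using h

lemma tendsto_inv_sqrt_nat : Tendsto (fun M : ℕ => (√(M : ℝ))⁻¹) atTop (nhds 0) :=
  (Real.tendsto_sqrt_atTop.comp tendsto_natCast_atTop_atTop).inv_tendsto_atTop

lemma tendsto_sum_Ico_binaryExcess :
    Tendsto (fun M : ℕ => ∑ k ∈ Finset.Ico M (2 * M), (binaryExcess k : ℝ) * harmonicLogGap k)
      atTop (nhds 0) := by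
  refine squeeze_zero_norm' ?_ (by simpa using tendsto_inv_sqrt_nat.const_mul (3 * √2))
  filter_upwards [eventually_gt_atTop 0] with M hM
  have hM' : (0 : ℝ) < M := by exact_mod_cast hM
  have hterm : ∀ k ∈ Finset.Ico M (2 * M),
      ‖(binaryExcess k : ℝ) * harmonicLogGap k‖ ≤ 3 * √(2 * M : ℝ) * (1 / (M : ℝ) ^ 2) := by
    intro k hk
    rw [Finset.mem_Ico] at hk
    have h1 : (M : ℝ) ≤ k := by exact_mod_cast hk.1
    have h2 : (k : ℝ) ≤ 2 * M := by exact_mod_cast hk.2.le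
    rw [norm_mul, Real.norm_eq_abs, Real.norm_eq_abs, abs_of_nonneg (harmonicLogGap_nonneg k)]
    refine mul_le_mul ((abs_binaryExcess_le k).trans (by gcongr))
      ((harmonicLogGap_le k).trans (by gcongr)) (harmonicLogGap_nonneg k) (by positivity)
  refine (norm_sum_le_of_le _ hterm).trans (le_of_eq ?_)
  rw [Finset.sum_const, Nat.card_Ico, show 2 * M - M = M by omega, nsmul_eq_mul,
    Real.sqrt_mul (by norm_num)]
  have hs : √(M : ℝ) ≠ 0 := by positivity
  have hsq : √(M : ℝ) ^ 2 = M := Real.sq_sqrt hM'.le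
  field_simp
  rw [hsq]

lemma tendsto_sum_binaryExcess :
    Tendsto (fun M : ℕ => ∑ m ∈ Finset.range M,
        (binaryExcess m : ℝ) * (1 / (2 * m : ℝ) - 1 / (2 * m + 1)))
      atTop (nhds (Real.log (4 / Real.pi))) := by
  simp only [sum_binaryExcess_eq]
  have h := tendsto_harmonicLogGap.comp (tendsto_id.const_mul_atTop' (show 0 < 2 by norm_num))
  simpa using (tendsto_sum_harmonicLogGap.add h).sub tendsto_sum_Ico_binaryExcess

lemma sum_range_two_mul_binaryExcess (M : ℕ) :
    ∑ n ∈ Finset.range (2 * M), (-1 : ℝ) ^ n * (binaryExcess (n / 2) : ℝ) / n =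
      ∑ m ∈ Finset.range M, (binaryExcess m : ℝ) * (1 / (2 * m : ℝ) - 1 / (2 * m + 1)) := by
  induction M with
  | zero => simp
  | succ M ih =>
    rw [show 2 * (M + 1) = 2 * M + 1 + 1 by ring, Finset.sum_range_succ, Finset.sum_range_succ,
      ih, Finset.sum_range_succ, show (2 * M + 1) / 2 = M by omega,
      show 2 * M / 2 = M by omega, pow_succ, pow_mul]
    push_cast
    ring

lemma norm_binaryExcess_term_le (n : ℕ) :
    ‖(-1 : ℝ) ^ n * (binaryExcess (n / 2) : ℝ) / n‖ ≤ 3 * (√(n : ℝ))⁻¹ := by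
  rcases Nat.eq_zero_or_pos n with rfl | hn
  · simp
  have hn' : (0 : ℝ) < n := by exact_mod_cast hn
  have hs : 0 < √(n : ℝ) := by positivity
  have hsq : √(n : ℝ) * √(n : ℝ) = n := Real.mul_self_sqrt hn'.le
  have h := abs_binaryExcess_le (n / 2)
  have h2 : √((n / 2 : ℕ) : ℝ) ≤ √(n : ℝ) :=
    Real.sqrt_le_sqrt (by exact_mod_cast Nat.div_le_self n 2)
  rw [norm_div, norm_mul, norm_pow, norm_neg, norm_one, one_pow, one_mul, Real.norm_eq_abs,
    Real.norm_natCast, div_le_iff₀ hn']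
  calc |(binaryExcess (n / 2) : ℝ)| ≤ 3 * √(n : ℝ) := by linarith
    _ = 3 * (√(n : ℝ))⁻¹ * n := by
      field_simp
      linarith

lemma tendsto_sum_range_binaryExcess :
    Tendsto (fun N : ℕ => ∑ n ∈ Finset.range N, (-1 : ℝ) ^ n * (binaryExcess (n / 2) : ℝ) / n)
      atTop (nhds (Real.log (4 / Real.pi))) := by
  set t : ℕ → ℝ := fun n => (-1 : ℝ) ^ n * (binaryExcess (n / 2) : ℝ) / n
  have ht : Tendsto t atTop (nhds 0) :=
    squeeze_zero_norm norm_binaryExcess_term_le (by simpa using tendsto_inv_sqrt_nat.const_mul 3)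
  have hhalf : Tendsto (fun N : ℕ => N / 2) atTop atTop :=
    Nat.tendsto_div_const_atTop two_ne_zero
  have hmain : Tendsto (fun N : ℕ => ∑ n ∈ Finset.range (2 * (N / 2)), t n)
      atTop (nhds (Real.log (4 / Real.pi))) := by
    simp only [t, sum_range_two_mul_binaryExcess]
    exact tendsto_sum_binaryExcess.comp hhalf
  have herr : Tendsto (fun N : ℕ => ∑ n ∈ Finset.range N, t n -
      ∑ n ∈ Finset.range (2 * (N / 2)), t n) atTop (nhds 0) := by
    have hd : Tendsto (fun N : ℕ => ‖t (2 * (N / 2))‖) atTop (nhds 0) := by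
      simpa using (ht.comp ((tendsto_id.const_mul_atTop' (show 0 < 2 by norm_num)).comp hhalf)).norm
    refine squeeze_zero_norm (fun N => ?_) hd
    obtain ⟨m, rfl | rfl⟩ := Nat.even_or_odd' N
    · simp
    · rw [show (2 * m + 1) / 2 = m by omega, Finset.sum_range_succ, add_sub_cancel_left]
  simpa using herr.add hmain

/-- `ln(4/π) = Σ_{n=2}^∞ (-1)^n (N₁(⌊n/2⌋)-N₀(⌊n/2⌋))/n`, interpreted as the
limit of partial sums. -/
theorem log_four_div_pi_vacca :
    Tendsto (fun N : ℕ => ∑ n ∈ Finset.Icc 2 N,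
        (-1 : ℝ) ^ n *
          ((((Nat.digits 2 (n / 2)).count 1 : ℤ) - ((Nat.digits 2 (n / 2)).count 0 : ℤ) : ℤ) : ℝ) / n)
      atTop (nhds (Real.log (4 / Real.pi))) := by
  refine (tendsto_sum_range_binaryExcess.comp (tendsto_add_atTop_nat 1)).congr fun N => ?_
  symm
  refine Finset.sum_subset (fun n hn => ?_) fun n hn hn' => ?_
  · rw [Finset.mem_Icc] at hn
    exact Finset.mem_range.mpr (by dsimp only; omega)
  · simp only [Finset.mem_range] at hn
    rw [Finset.mem_Icc] at hn'
    simp [show n / 2 = 0 by omega]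
end
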